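/- Let φ ∈ J_{k,2}(O_K) with theta components h_{a,b} (a,b ∈ ℤ/4ℤ). Then the classical Jacobi form π_{1+i} φ ∈ J_{k,4} has theta decomposition (π_{1+i} φ)(τ,z) = Σ_{μ ∈ ℤ/8ℤ} H̄_μ(τ) θ_{4,μ}(τ,z), where H̄_μ = Σ_{a ∈ ℤ/4ℤ} h_{a, a-μ} b_{2a-μ} (the first subscript of h read mod 4, the subscript of b read mod 8) and H̄_μ = (-1)^k H̄_{-μ}. Explicitly, H̄_0 = h_{0,0}b_0 + h_{1,1}b_2 + h_{2,2}b_4 + h_{3,3}b_6, H̄_1 = h_{1,0}b_1 + h_{2,1}b_3 + h_{3,2}b_5 + h_{0,3}b_7, H̄_2 = h_{2,0}b_2 + h_{3,1}b_4 + h_{0,2}b_6 + h_{1,3}b_0, H̄_3 = h_{3,0}b_3 + h_{0,1}b_5 + h_{1,2}b_7 + h_{2,3}b_1, H̄_4 = h_{0,0}b_4 + h_{1,1}b_6 + h_{2,2}b_0 + h_{3,3}b_2. -/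

import Mathlib

noncomputable section

open Complex

/-- `τ` lies in the upper half plane. -/
def UHP (τ : ℂ) : Prop := 0 < τ.im

/-- `eC w = exp(2 π i w)`. -/
def eC (w : ℂ) : ℂ := Complex.exp (2 * (Real.pi : ℂ) * Complex.I * w)

/-- Entries of a matrix in `SL(2, ℤ)`, as complex numbers. -/
def Ma (M : Matrix.SpecialLinearGroup (Fin 2) ℤ) : ℂ := ((M.1 0 0 : ℤ) : ℂ)
def Mb (M : Matrix.SpecialLinearGroup (Fin 2) ℤ) : ℂ := ((M.1 0 1 : ℤ) : ℂ)
def Mc (M : Matrix.SpecialLinearGroup (Fin 2) ℤ) : ℂ := ((M.1 1 0 : ℤ) : ℂ)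
def Md (M : Matrix.SpecialLinearGroup (Fin 2) ℤ) : ℂ := ((M.1 1 1 : ℤ) : ℂ)

/-- Hermitian Jacobi form of weight `k` and index `m` for the Hermitian Jacobi group over
`ℤ[i]`.  A form is a function `φ : ℂ → ℂ → ℂ → ℂ`, all conditions being imposed for `τ`
in the upper half plane.  Units `ε ∈ ℤ[i]ˣ = {1, -1, i, -i}`, and the elliptic variables
`λ = p + q i`, `μ = u + v i` range over `ℤ[i]`.  The Fourier expansion is indexed by
`n ∈ ℕ` and `r = (a + b i)/2 ∈ O_K^♯ = (i/2)ℤ[i]`, supported on `N(r) ≤ n m`,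
i.e. `a² + b² ≤ 4 n m`. -/
structure IsHJF (k m : ℕ) (φ : ℂ → ℂ → ℂ → ℂ) : Prop where
  holo : DifferentiableOn ℂ (fun p : ℂ × ℂ × ℂ => φ p.1 p.2.1 p.2.2) {p | UHP p.1}
  transf : ∀ ε : ℂ, ε ∈ ({1, -1, Complex.I, -Complex.I} : Set ℂ) →
    ∀ M : Matrix.SpecialLinearGroup (Fin 2) ℤ, ∀ τ z₁ z₂ : ℂ, UHP τ →
      φ ((Ma M * τ + Mb M) / (Mc M * τ + Md M))
        (ε * z₁ / (Mc M * τ + Md M))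
        ((starRingEnd ℂ) ε * z₂ / (Mc M * τ + Md M))
      = ε ^ k * (Mc M * τ + Md M) ^ k *
          eC ((m : ℂ) * Mc M * z₁ * z₂ / (Mc M * τ + Md M)) * φ τ z₁ z₂
  ellip : ∀ p q u v : ℤ, ∀ τ z₁ z₂ : ℂ, UHP τ →
      φ τ (z₁ + ((p : ℂ) + (q : ℂ) * Complex.I) * τ + ((u : ℂ) + (v : ℂ) * Complex.I))
          (z₂ + ((p : ℂ) - (q : ℂ) * Complex.I) * τ + ((u : ℂ) - (v : ℂ) * Complex.I))
      = eC (-(m : ℂ) * (((p : ℂ) ^ 2 + (q : ℂ) ^ 2) * τ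
          + ((p : ℂ) - (q : ℂ) * Complex.I) * z₁
          + ((p : ℂ) + (q : ℂ) * Complex.I) * z₂)) * φ τ z₁ z₂
  fourier : ∃ c : ℕ → ℤ → ℤ → ℂ,
      (∀ (n : ℕ) (a b : ℤ), 4 * (n : ℤ) * m < a ^ 2 + b ^ 2 → c n a b = 0) ∧
      ∀ τ z₁ z₂ : ℂ, UHP τ →
        HasSum (fun p : ℕ × ℤ × ℤ => c p.1 p.2.1 p.2.2 *
          eC ((p.1 : ℂ) * τ + (((p.2.1 : ℂ) + (p.2.2 : ℂ) * Complex.I) / 2) * z₁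
            + (((p.2.1 : ℂ) - (p.2.2 : ℂ) * Complex.I) / 2) * z₂)) (φ τ z₁ z₂)

/-- Classical Jacobi form of weight `k` and index `m` for `SL(2,ℤ) ⋉ ℤ²`. -/
structure IsJF (k m : ℕ) (φ : ℂ → ℂ → ℂ) : Prop where
  holo : DifferentiableOn ℂ (fun p : ℂ × ℂ => φ p.1 p.2) {p | UHP p.1}
  transf : ∀ M : Matrix.SpecialLinearGroup (Fin 2) ℤ, ∀ τ z : ℂ, UHP τ →
      φ ((Ma M * τ + Mb M) / (Mc M * τ + Md M)) (z / (Mc M * τ + Md M))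
      = (Mc M * τ + Md M) ^ k *
          eC ((m : ℂ) * Mc M * z ^ 2 / (Mc M * τ + Md M)) * φ τ z
  ellip : ∀ p q : ℤ, ∀ τ z : ℂ, UHP τ →
      φ τ (z + (p : ℂ) * τ + (q : ℂ))
      = eC (-(m : ℂ) * ((p : ℂ) ^ 2 * τ + 2 * (p : ℂ) * z)) * φ τ z
  fourier : ∃ c : ℕ → ℤ → ℂ,
      (∀ (n : ℕ) (r : ℤ), 4 * (n : ℤ) * m < r ^ 2 → c n r = 0) ∧
      ∀ τ z : ℂ, UHP τ →
        HasSum (fun p : ℕ × ℤ => c p.1 p.2 * eC ((p.1 : ℂ) * τ + (p.2 : ℂ) * z)) (φ τ z)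

/-- Modular form of weight `k` for `SL(2,ℤ)`. -/
structure IsMF (k : ℕ) (f : ℂ → ℂ) : Prop where
  holo : DifferentiableOn ℂ f {τ | UHP τ}
  transf : ∀ M : Matrix.SpecialLinearGroup (Fin 2) ℤ, ∀ τ : ℂ, UHP τ →
      f ((Ma M * τ + Mb M) / (Mc M * τ + Md M)) = (Mc M * τ + Md M) ^ k * f τ
  bounded : ∃ A B : ℝ, ∀ τ : ℂ, B ≤ τ.im → ‖f τ‖ ≤ A

/-- Cusp form of weight `k` for `SL(2,ℤ)`. -/
structure IsCF (k : ℕ) (f : ℂ → ℂ) : Prop where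
  holo : DifferentiableOn ℂ f {τ | UHP τ}
  transf : ∀ M : Matrix.SpecialLinearGroup (Fin 2) ℤ, ∀ τ : ℂ, UHP τ →
      f ((Ma M * τ + Mb M) / (Mc M * τ + Md M)) = (Mc M * τ + Md M) ^ k * f τ
  decay : ∀ ε : ℝ, 0 < ε → ∃ B : ℝ, ∀ τ : ℂ, B ≤ τ.im → ‖f τ‖ ≤ ε

/-- `M_w(SL(2,ℤ), ω̄)` for the character `ω` of `SL(2,ℤ)` with `ω(T) = ω(S) = i`:
holomorphic functions on the upper half plane, bounded at infinity, with
`f|_w T = -i f` and `f|_w S = -i f`. -/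
structure IsMFOmegaBar (w : ℕ) (f : ℂ → ℂ) : Prop where
  holo : DifferentiableOn ℂ f {τ | UHP τ}
  transT : ∀ τ : ℂ, UHP τ → f (τ + 1) = -Complex.I * f τ
  transS : ∀ τ : ℂ, UHP τ → f (-1 / τ) = -Complex.I * τ ^ w * f τ
  bounded : ∃ A B : ℝ, ∀ τ : ℂ, B ≤ τ.im → ‖f τ‖ ≤ A

/-- Hermitian theta function `θ^H_{m,s}` of index `m` with characteristic
`s = (a + b i)/2 ∈ O_K^♯`; the sum is over `r = s + m (g₁ + g₂ i) ∈ s + m ℤ[i]`. -/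
def thetaH (m : ℕ) (a b : ℤ) (τ z₁ z₂ : ℂ) : ℂ :=
  ∑' g : ℤ × ℤ,
    eC ((((a : ℂ) + 2 * m * g.1) ^ 2 + ((b : ℂ) + 2 * m * g.2) ^ 2) / (4 * m) * τ
      + (((a : ℂ) + 2 * m * g.1) + ((b : ℂ) + 2 * m * g.2) * Complex.I) / 2 * z₁
      + (((a : ℂ) + 2 * m * g.1) - ((b : ℂ) + 2 * m * g.2) * Complex.I) / 2 * z₂)

/-- Classical theta function `θ_{m,μ}(τ,z) = Σ_{r ≡ μ mod 2m} e(r²τ/(4m) + r z)`. -/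
def thetaJ (m : ℕ) (μ : ℤ) (τ z : ℂ) : ℂ :=
  ∑' g : ℤ, eC (((μ : ℂ) + 2 * m * g) ^ 2 / (4 * m) * τ + ((μ : ℂ) + 2 * m * g) * z)

/-- `h` is the family of theta components of `φ` (for index `m`): the `h_{a,b}` depend
only on `(a, b) mod 2m` and `φ = Σ_{s ∈ O_K^♯ / m O_K} h_s θ^H_{m,s}`. -/
def HasThetaDecomp (m : ℕ) (φ : ℂ → ℂ → ℂ → ℂ) (h : ℤ → ℤ → ℂ → ℂ) : Prop :=
  (∀ (a b : ℤ) (τ : ℂ), h (a + 2 * m) b τ = h a b τ ∧ h a (b + 2 * m) τ = h a b τ) ∧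
  ∀ τ z₁ z₂ : ℂ, UHP τ →
    φ τ z₁ z₂ = ∑ a ∈ Finset.range (2 * m), ∑ b ∈ Finset.range (2 * m),
      h (a : ℤ) (b : ℤ) τ * thetaH m (a : ℤ) (b : ℤ) τ z₁ z₂

/-- `ϑ₀(τ) = Σ_{r ∈ ℤ} e(r² τ)`. -/
def theta0C (τ : ℂ) : ℂ := ∑' r : ℤ, eC ((r : ℂ) ^ 2 * τ)

/-- `ϑ₁(τ) = Σ_{r odd} e(r² τ / 4)`. -/
def theta1C (τ : ℂ) : ℂ := ∑' r : ℤ, eC ((2 * (r : ℂ) + 1) ^ 2 * τ / 4)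

/-- `ξ = ϑ₁ ϑ₀' − ϑ₀ ϑ₁'`. -/
def xiC (τ : ℂ) : ℂ := theta1C τ * deriv theta0C τ - theta0C τ * deriv theta1C τ

/-- Taylor coefficient `χ_{α,β}(τ)` of `φ(τ, z₁, z₂)` around `z₁ = z₂ = 0`. -/
def chiHJF (φ : ℂ → ℂ → ℂ → ℂ) (α β : ℕ) (τ : ℂ) : ℂ :=
  (1 / ((α.factorial : ℂ) * (β.factorial : ℂ))) *
    iteratedDeriv α (fun z₁ => iteratedDeriv β (fun z₂ => φ τ z₁ z₂) 0) 0

/-- `D₀ : J_{k,m} → M_k`, `ψ ↦ ψ(·, 0)`. -/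
def D0J (ψ : ℂ → ℂ → ℂ) : ℂ → ℂ := fun τ => ψ τ 0

/-- `D₂ : J_{k,m} → S_{k+2}`, `D₂ψ = (2k/(2πi)²) ψ₂ − (2m/(2πi)) ψ₀'`, where `ψ_ν` are
the Taylor coefficients of `ψ` around `z = 0`. -/
def D2J (k m : ℕ) (ψ : ℂ → ℂ → ℂ) : ℂ → ℂ := fun τ =>
  (2 * (k : ℂ) / (2 * (Real.pi : ℂ) * Complex.I) ^ 2) *
      ((1 / 2) * iteratedDeriv 2 (fun z => ψ τ z) 0)
    - (2 * (m : ℂ) / (2 * (Real.pi : ℂ) * Complex.I)) * deriv (fun t => ψ t 0) τ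

/-- Normalized Eisenstein series `E₄`. -/
def E4C (τ : ℂ) : ℂ :=
  1 + 240 * ∑' n : ℕ, ((ArithmeticFunction.sigma 3) n : ℂ) * eC ((n : ℂ) * τ)

/-- Normalized Eisenstein series `E₆`. -/
def E6C (τ : ℂ) : ℂ :=
  1 - 504 * ∑' n : ℕ, ((ArithmeticFunction.sigma 5) n : ℂ) * eC ((n : ℂ) * τ)

/-- `f` agrees on the upper half plane with a polynomial in `E₄` and `E₆²` that is
homogeneous of weight `k - v`, i.e. supported on `4a + 12b + v = k`. -/
def IsE4E6sqPoly (v k : ℕ) (f : ℂ → ℂ) : Prop :=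
  ∃ lam : ℕ × ℕ → ℂ, ∀ τ : ℂ, UHP τ →
    f τ = ∑ p ∈ (Finset.range (k + 1) ×ˢ Finset.range (k + 1)).filter
        (fun p => 4 * p.1 + 12 * p.2 + v = k),
      lam p * E4C τ ^ p.1 * E6C τ ^ (2 * p.2)

/-- The slash action `φ|_{k,m} M` of `M ∈ SL(2,ℤ)` on functions `ℂ → ℂ → ℂ → ℂ`. -/
def slashHJF (k m : ℕ) (φ : ℂ → ℂ → ℂ → ℂ) (M : Matrix.SpecialLinearGroup (Fin 2) ℤ)
    (τ z₁ z₂ : ℂ) : ℂ :=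
  ((Mc M * τ + Md M) ^ k)⁻¹ *
    eC (-(m : ℂ) * Mc M * z₁ * z₂ / (Mc M * τ + Md M)) *
    φ ((Ma M * τ + Mb M) / (Mc M * τ + Md M)) (z₁ / (Mc M * τ + Md M)) (z₂ / (Mc M * τ + Md M))

/-- Hermitian Jacobi form of weight `k` and index `m` for the congruence subgroup `Γ₀(N)`,
with at each cusp a Fourier expansion supported on `(n, r) ∈ ℚ_{≥0} × O_K^♯`
with `N(r) ≤ n m`. -/
structure IsHJFLevel (k m N : ℕ) (φ : ℂ → ℂ → ℂ → ℂ) : Prop where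
  holo : DifferentiableOn ℂ (fun p : ℂ × ℂ × ℂ => φ p.1 p.2.1 p.2.2) {p | UHP p.1}
  transf : ∀ ε : ℂ, ε ∈ ({1, -1, Complex.I, -Complex.I} : Set ℂ) →
    ∀ M : Matrix.SpecialLinearGroup (Fin 2) ℤ, (N : ℤ) ∣ M.1 1 0 →
    ∀ τ z₁ z₂ : ℂ, UHP τ →
      φ ((Ma M * τ + Mb M) / (Mc M * τ + Md M))
        (ε * z₁ / (Mc M * τ + Md M))
        ((starRingEnd ℂ) ε * z₂ / (Mc M * τ + Md M))
      = ε ^ k * (Mc M * τ + Md M) ^ k *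
          eC ((m : ℂ) * Mc M * z₁ * z₂ / (Mc M * τ + Md M)) * φ τ z₁ z₂
  ellip : ∀ p q u v : ℤ, ∀ τ z₁ z₂ : ℂ, UHP τ →
      φ τ (z₁ + ((p : ℂ) + (q : ℂ) * Complex.I) * τ + ((u : ℂ) + (v : ℂ) * Complex.I))
          (z₂ + ((p : ℂ) - (q : ℂ) * Complex.I) * τ + ((u : ℂ) - (v : ℂ) * Complex.I))
      = eC (-(m : ℂ) * (((p : ℂ) ^ 2 + (q : ℂ) ^ 2) * τ
          + ((p : ℂ) - (q : ℂ) * Complex.I) * z₁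
          + ((p : ℂ) + (q : ℂ) * Complex.I) * z₂)) * φ τ z₁ z₂
  cusp : ∀ M : Matrix.SpecialLinearGroup (Fin 2) ℤ,
      ∃ c : ℚ → ℤ → ℤ → ℂ,
        (∀ (n : ℚ) (a b : ℤ),
          ¬ (0 ≤ n ∧ ((a : ℚ) ^ 2 + (b : ℚ) ^ 2) ≤ 4 * n * m) → c n a b = 0) ∧
        ∀ τ z₁ z₂ : ℂ, UHP τ →
          HasSum (fun p : ℚ × ℤ × ℤ => c p.1 p.2.1 p.2.2 *
            eC ((p.1 : ℂ) * τ + (((p.2.1 : ℂ) + (p.2.2 : ℂ) * Complex.I) / 2) * z₁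
              + (((p.2.1 : ℂ) - (p.2.2 : ℂ) * Complex.I) / 2) * z₂))
            (slashHJF k m φ M τ z₁ z₂)

/-- Theta constant `x`. -/
def thConstX (τ : ℂ) : ℂ := ∑' n : ℤ, eC ((n : ℂ) ^ 2 * τ / 2)

/-- Theta constant `y`. -/
def thConstY (τ : ℂ) : ℂ := ∑' n : ℤ, (-1 : ℂ) ^ n * eC ((n : ℂ) ^ 2 * τ / 2)

/-- Theta constant `z`. -/
def thConstZ (τ : ℂ) : ℂ := ∑' n : ℤ, eC (((n : ℂ) + 1 / 2) ^ 2 * τ / 2)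

/-- The coefficient `H̄_μ = Σ_{a mod 4} h_{a, a-μ} b_{2a-μ}`. -/
def HbarF (h : ℤ → ℤ → ℂ → ℂ) (μ : ℤ) (τ : ℂ) : ℂ :=
  ∑ a ∈ Finset.range 4, h (a : ℤ) ((a : ℤ) - μ) τ * thetaJ 4 (2 * (a : ℤ) - μ) τ 0

theorem eC_add (x y : ℂ) : eC (x + y) = eC x * eC y := by
  unfold eC; rw [← Complex.exp_add]; ring_nf

theorem eC_zero : eC 0 = 1 := by simp [eC]

theorem eC_int (n : ℤ) : eC (n : ℂ) = 1 := by
  unfold eC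
  rw [Complex.exp_eq_one_iff]
  exact ⟨n, by ring⟩

theorem norm_eC_real (x : ℝ) : ‖eC (x : ℂ)‖ = 1 := by
  unfold eC
  have : 2 * (Real.pi : ℂ) * Complex.I * (x : ℂ) = ((2 * Real.pi * x : ℝ) : ℂ) * Complex.I := by
    push_cast; ring
  rw [this, Complex.norm_exp_ofReal_mul_I]

theorem thetaJ_term (μ g : ℤ) (τ z : ℂ) :
    eC (((μ : ℂ) + 2 * (4 : ℕ) * g) ^ 2 / (4 * (4 : ℕ)) * τ + ((μ : ℂ) + 2 * (4 : ℕ) * g) * z)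
      = eC ((μ : ℂ) ^ 2 / 16 * τ + μ * z) * jacobiTheta₂_term g (μ * τ + 8 * z) (8 * τ) := by
  unfold eC jacobiTheta₂_term
  rw [← Complex.exp_add]
  congr 1
  push_cast
  ring

theorem thetaJ_summable (μ : ℤ) (τ z : ℂ) (hτ : UHP τ) :
    Summable (fun g : ℤ =>
      eC (((μ : ℂ) + 2 * (4 : ℕ) * g) ^ 2 / (4 * (4 : ℕ)) * τ
        + ((μ : ℂ) + 2 * (4 : ℕ) * g) * z)) := by
  simp_rw [thetaJ_term]
  apply Summable.mul_left
  rw [summable_jacobiTheta₂_term_iff]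
  have : 0 < τ.im := hτ
  simpa using this

theorem thetaJ_eq (μ : ℤ) (τ z : ℂ) :
    thetaJ 4 μ τ z = eC ((μ : ℂ) ^ 2 / 16 * τ + μ * z) * jacobiTheta₂ (μ * τ + 8 * z) (8 * τ) := by
  unfold thetaJ jacobiTheta₂
  simp_rw [thetaJ_term]
  rw [tsum_mul_left]

theorem thetaJ_continuous (μ : ℤ) (τ : ℂ) (hτ : UHP τ) : Continuous (fun z => thetaJ 4 μ τ z) := by
  simp_rw [thetaJ_eq]
  have h8 : 0 < (8 * τ).im := by
    have : 0 < τ.im := hτ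
    simpa using this
  apply Continuous.mul
  · unfold eC; fun_prop
  · have h1 : Continuous (fun w => jacobiTheta₂ w (8 * τ)) :=
      continuous_iff_continuousAt.2
        fun w => (differentiableAt_jacobiTheta₂_fst w h8).continuousAt
    exact h1.comp (by fun_prop)

theorem thetaJ_period (μ : ℤ) (τ z : ℂ) : thetaJ 4 (μ + 8) τ z = thetaJ 4 μ τ z := by
  unfold thetaJ
  rw [← (Equiv.addRight (1 : ℤ)).tsum_eq (fun g : ℤ =>
      eC (((μ : ℂ) + 2 * (4 : ℕ) * g) ^ 2 / (4 * (4 : ℕ)) * τ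
        + ((μ : ℂ) + 2 * (4 : ℕ) * g) * z))]
  refine tsum_congr fun g => ?_
  congr 1
  simp only [Equiv.coe_addRight]
  push_cast
  ring

theorem thetaJ_neg (μ : ℤ) (τ z : ℂ) : thetaJ 4 μ τ (-z) = thetaJ 4 (-μ) τ z := by
  unfold thetaJ
  rw [← (Equiv.neg ℤ).tsum_eq (fun g : ℤ =>
      eC (((-μ : ℤ) + 2 * (4 : ℕ) * g) ^ 2 / (4 * (4 : ℕ)) * τ
        + (((-μ : ℤ) : ℂ) + 2 * (4 : ℕ) * g) * z))]
  refine tsum_congr fun g => ?_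
  congr 1
  simp only [Equiv.neg_apply]
  push_cast
  ring

/-- Pairs of integers, split by the parity of the sum of the coordinates. -/
def splitEquiv : (ℤ × ℤ) ⊕ (ℤ × ℤ) ≃ ℤ × ℤ where
  toFun x := match x with
    | Sum.inl p => (p.1 + p.2, p.2 - p.1)
    | Sum.inr p => (p.1 + p.2 + 1, p.2 - p.1)
  invFun q := if (q.1 - q.2) % 2 = 0 then Sum.inl ((q.1 - q.2) / 2, (q.1 + q.2) / 2)
    else Sum.inr ((q.1 - q.2) / 2, (q.1 + q.2) / 2)
  left_inv x := by
    rcases x with ⟨u, v⟩ | ⟨u, v⟩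
    · have h : (u + v - (v - u)) % 2 = 0 := by omega
      simp only [h, if_true]
      congr 2 <;> omega
    · have h : ¬ (u + v + 1 - (v - u)) % 2 = 0 := by omega
      simp only [h, if_false]
      congr 2 <;> omega
  right_inv q := by
    rcases q with ⟨a, b⟩
    by_cases h : (a - b) % 2 = 0
    · simp only [h, if_true]
      ext <;> simp only <;> omega
    · simp only [h, if_false]
      ext <;> simp only <;> omega

theorem thetaH_split (a b : ℤ) (τ z : ℂ) (hτ : UHP τ) :
    thetaH 2 a b τ ((1 + Complex.I) * z) ((1 - Complex.I) * z)
      = thetaJ 4 (a - b) τ z * thetaJ 4 (a + b) τ 0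
        + thetaJ 4 (a - b + 4) τ z * thetaJ 4 (a + b + 4) τ 0 := by
  have key : ∀ μ ν : ℤ, HasSum (fun p : ℤ × ℤ =>
      eC (((μ : ℂ) + 2 * (4 : ℕ) * p.1) ^ 2 / (4 * (4 : ℕ)) * τ
        + ((μ : ℂ) + 2 * (4 : ℕ) * p.1) * z) *
      eC (((ν : ℂ) + 2 * (4 : ℕ) * p.2) ^ 2 / (4 * (4 : ℕ)) * τ
        + ((ν : ℂ) + 2 * (4 : ℕ) * p.2) * 0)) (thetaJ 4 μ τ z * thetaJ 4 ν τ 0) := by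
    intro μ ν
    have h1 := thetaJ_summable μ τ z hτ
    have h2 := thetaJ_summable ν τ 0 hτ
    have h3 := summable_mul_of_summable_norm h1.norm h2.norm
    have h4 := tsum_mul_tsum_of_summable_norm h1.norm h2.norm
    unfold thetaJ
    rw [h4]
    exact h3.hasSum
  unfold thetaH
  apply HasSum.tsum_eq
  rw [← splitEquiv.hasSum_iff]
  apply HasSum.sum
  · convert key (a - b) (a + b) using 2 with p
    simp only [Function.comp_apply, splitEquiv, Equiv.coe_fn_mk]
    rw [← eC_add]
    congr 1
    push_cast
    linear_combination (((b : ℂ) + 4 * (p.2 - p.1)) * z) * Complex.I_sq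
  · convert key (a - b + 4) (a + b + 4) using 2 with p
    simp only [Function.comp_apply, splitEquiv, Equiv.coe_fn_mk]
    rw [← eC_add]
    congr 1
    push_cast
    linear_combination (((b : ℂ) + 4 * (p.2 - p.1)) * z) * Complex.I_sq

theorem integral_eC_int (n : ℤ) : ∫ x in (0 : ℝ)..1, eC ((n : ℂ) * x) = if n = 0 then 1 else 0 := by
  split_ifs with h
  · subst h; simp [eC_zero]
  · have hc : 2 * (Real.pi : ℂ) * Complex.I * n ≠ 0 := by
      simp [Real.pi_ne_zero, h]
    have := integral_exp_mul_complex (a := 0) (b := 1) hc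
    have h2 := eC_int n
    unfold eC at *
    simp_rw [← mul_assoc]
    rw [this]
    simp [h2]

theorem thetaJ_coeff (μ ν : ℤ) (τ : ℂ) (hτ : UHP τ) :
    ∫ x in (0 : ℝ)..1, thetaJ 4 μ τ x * eC (((-ν : ℤ) : ℂ) * x)
      = if (8 : ℤ) ∣ μ - ν then eC ((ν : ℂ) ^ 2 / 16 * τ) else 0 := by
  set A : ℤ → ℂ := fun g => eC (((μ : ℂ) + 2 * (4 : ℕ) * g) ^ 2 / (4 * (4 : ℕ)) * τ
        + ((μ : ℂ) + 2 * (4 : ℕ) * g) * 0) with hA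
  have hAs : Summable A := thetaJ_summable μ τ 0 hτ
  have hterm : ∀ (g : ℤ) (x : ℝ), eC (((μ : ℂ) + 2 * (4 : ℕ) * g) ^ 2 / (4 * (4 : ℕ)) * τ
        + ((μ : ℂ) + 2 * (4 : ℕ) * g) * x) * eC (((-ν : ℤ) : ℂ) * x)
        = A g * eC (((μ + 8 * g - ν : ℤ) : ℂ) * x) := by
    intro g x
    simp only [hA]
    rw [← eC_add, ← eC_add]
    congr 1
    push_cast
    ring
  have hcont : ∀ n : ℤ, Continuous (fun x : ℝ => eC ((n : ℂ) * x)) := by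
    intro n; unfold eC; fun_prop
  have hs := intervalIntegral.hasSum_integral_of_dominated_convergence
    (μ := MeasureTheory.volume) (a := (0 : ℝ)) (b := 1)
    (F := fun (g : ℤ) (x : ℝ) => A g * eC (((μ + 8 * g - ν : ℤ) : ℂ) * x))
    (f := fun x : ℝ => thetaJ 4 μ τ x * eC (((-ν : ℤ) : ℂ) * x))
    (fun g _ => ‖A g‖)
    (fun g => ((continuous_const.mul (hcont _)).aestronglyMeasurable))
    (fun g => Filter.Eventually.of_forall fun x _ => by
      rw [norm_mul]
      have := norm_eC_real (((μ + 8 * g - ν : ℤ) : ℝ) * x)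
      push_cast at this ⊢
      rw [this, mul_one])
    (Filter.Eventually.of_forall fun x _ => hAs.norm)
    (by simp)
    (Filter.Eventually.of_forall fun x _ => by
      have h1 := (thetaJ_summable μ τ x hτ).hasSum.mul_right (eC (((-ν : ℤ) : ℂ) * x))
      simp_rw [hterm] at h1
      exact h1)
  simp_rw [intervalIntegral.integral_const_mul, integral_eC_int] at hs
  rw [← hs.tsum_eq]
  split_ifs with h
  · obtain ⟨q, hq⟩ := h
    rw [tsum_eq_single (-q)]
    · rw [if_pos (by omega), mul_one]
      simp only [hA]
      have : (μ : ℂ) = ν + 8 * q := by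
        have : μ = ν + 8 * q := by omega
        rw [this]; push_cast; ring
      rw [this]
      congr 1
      push_cast
      ring
    · intro g hg
      rw [if_neg (by omega), mul_zero]
  · have : ∀ g : ℤ, A g * (if μ + 8 * g - ν = 0 then (1 : ℂ) else 0) = 0 := by
      intro g
      rw [if_neg, mul_zero]
      intro h0
      exact h ⟨-g, by omega⟩
    simp_rw [this]
    exact tsum_zero

theorem sum_pick (H : ℤ → ℂ) (hH : ∀ μ, H (μ + 8) = H μ) (ν : ℤ) (c : ℂ) :
    ∑ μ ∈ Finset.range 8, H (μ : ℤ) * (if (8 : ℤ) ∣ (μ : ℤ) - ν then c else 0) = H ν * c := by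
  have hper : Function.Periodic H 8 := hH
  have hmod : H (ν % 8) = H ν := by
    have h1 := hper.sub_zsmul_eq (x := ν) (ν / 8)
    rw [← h1]
    congr 1
    simp only [smul_eq_mul]
    omega
  rw [Finset.sum_eq_single (ν % 8).toNat]
  · have h0 : ((ν % 8).toNat : ℤ) = ν % 8 := Int.toNat_of_nonneg (by omega)
    rw [h0, hmod, if_pos (by omega)]
  · intro b hb hne
    rw [Finset.mem_range] at hb
    rw [if_neg (by omega), mul_zero]
  · intro hn
    exfalso; apply hn
    rw [Finset.mem_range]
    omega

theorem thetaSum_coeff (H : ℤ → ℂ) (hH : ∀ μ, H (μ + 8) = H μ) (ν : ℤ) (τ : ℂ) (hτ : UHP τ) :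
    ∫ x in (0 : ℝ)..1, (∑ μ ∈ Finset.range 8, H (μ : ℤ) * thetaJ 4 (μ : ℤ) τ x)
        * eC (((-ν : ℤ) : ℂ) * x) = H ν * eC ((ν : ℂ) ^ 2 / 16 * τ) := by
  simp_rw [Finset.sum_mul, mul_assoc]
  rw [intervalIntegral.integral_finsetSum]
  · simp_rw [intervalIntegral.integral_const_mul, thetaJ_coeff _ _ _ hτ]
    exact sum_pick H hH ν _
  · intro i _
    apply Continuous.intervalIntegrable
    have := (thetaJ_continuous i τ hτ).comp Complex.continuous_ofReal
    have h2 : Continuous (fun x : ℝ => eC (((-ν : ℤ) : ℂ) * x)) := by unfold eC; fun_prop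
    exact continuous_const.mul (this.mul h2)

theorem thetaSum_coeff_neg (H : ℤ → ℂ) (hH : ∀ μ, H (μ + 8) = H μ) (ν : ℤ) (τ : ℂ) (hτ : UHP τ) :
    ∫ x in (0 : ℝ)..1, (∑ μ ∈ Finset.range 8, H (μ : ℤ) * thetaJ 4 (μ : ℤ) τ (-x))
        * eC (((-ν : ℤ) : ℂ) * x) = H (-ν) * eC ((ν : ℂ) ^ 2 / 16 * τ) := by
  simp_rw [Finset.sum_mul, mul_assoc, thetaJ_neg]
  rw [intervalIntegral.integral_finsetSum]
  · simp_rw [intervalIntegral.integral_const_mul, thetaJ_coeff _ _ _ hτ]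
    rw [← sum_pick H hH (-ν) _]
    refine Finset.sum_congr rfl fun i _ => ?_
    have : (8 : ℤ) ∣ -(i : ℤ) - ν ↔ (8 : ℤ) ∣ (i : ℤ) - -ν := by omega
    simp only [this]
  · intro i _
    apply Continuous.intervalIntegrable
    have := (thetaJ_continuous (-i) τ hτ).comp Complex.continuous_ofReal
    have h2 : Continuous (fun x : ℝ => eC (((-ν : ℤ) : ℂ) * x)) := by unfold eC; fun_prop
    exact continuous_const.mul (this.mul h2)

/-- theta decomposition of `π_{1+i} φ` for `φ ∈ J_{k,2}(O_K)` with theta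
components `h_{a,b}`: `(π_{1+i}φ)(τ,z) = Σ_{μ mod 8} H̄_μ(τ) θ_{4,μ}(τ,z)` with
`H̄_μ = Σ_a h_{a,a-μ} b_{2a-μ}` and `H̄_μ = (-1)^k H̄_{-μ}`, together with the explicit
expressions for `H̄_0, …, H̄_4`. -/
theorem stmt9 (k : ℕ) (hk : 0 < k) (φ : ℂ → ℂ → ℂ → ℂ) (h : ℤ → ℤ → ℂ → ℂ)
    (hφ : IsHJF k 2 φ) (hdec : HasThetaDecomp 2 φ h) :
    (∀ τ z : ℂ, UHP τ →
      φ τ ((1 + Complex.I) * z) ((1 - Complex.I) * z)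
        = ∑ μ ∈ Finset.range 8, HbarF h (μ : ℤ) τ * thetaJ 4 (μ : ℤ) τ z) ∧
    (∀ (μ : ℤ) (τ : ℂ), UHP τ → HbarF h μ τ = (-1 : ℂ) ^ k * HbarF h (-μ) τ) ∧
    (∀ τ : ℂ, UHP τ →
      HbarF h 0 τ = h 0 0 τ * thetaJ 4 0 τ 0 + h 1 1 τ * thetaJ 4 2 τ 0
        + h 2 2 τ * thetaJ 4 4 τ 0 + h 3 3 τ * thetaJ 4 6 τ 0) ∧
    (∀ τ : ℂ, UHP τ →
      HbarF h 1 τ = h 1 0 τ * thetaJ 4 1 τ 0 + h 2 1 τ * thetaJ 4 3 τ 0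
        + h 3 2 τ * thetaJ 4 5 τ 0 + h 0 3 τ * thetaJ 4 7 τ 0) ∧
    (∀ τ : ℂ, UHP τ →
      HbarF h 2 τ = h 2 0 τ * thetaJ 4 2 τ 0 + h 3 1 τ * thetaJ 4 4 τ 0
        + h 0 2 τ * thetaJ 4 6 τ 0 + h 1 3 τ * thetaJ 4 0 τ 0) ∧
    (∀ τ : ℂ, UHP τ →
      HbarF h 3 τ = h 3 0 τ * thetaJ 4 3 τ 0 + h 0 1 τ * thetaJ 4 5 τ 0
        + h 1 2 τ * thetaJ 4 7 τ 0 + h 2 3 τ * thetaJ 4 1 τ 0) ∧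
    (∀ τ : ℂ, UHP τ →
      HbarF h 4 τ = h 0 0 τ * thetaJ 4 4 τ 0 + h 1 1 τ * thetaJ 4 6 τ 0
        + h 2 2 τ * thetaJ 4 0 τ 0 + h 3 3 τ * thetaJ 4 2 τ 0) := by
  have hb4 : ∀ (a b : ℤ) (τ : ℂ), h a (b + 4) τ = h a b τ := by
    intro a b τ
    have := (hdec.1 a b τ).2
    norm_num at this
    exact this
  have e1 : ∀ a τ, h a (-1) τ = h a 3 τ := fun a τ => (hb4 a (-1) τ).symm
  have e2 : ∀ a τ, h a (-2) τ = h a 2 τ := fun a τ => (hb4 a (-2) τ).symm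
  have e3 : ∀ a τ, h a (-3) τ = h a 1 τ := fun a τ => (hb4 a (-3) τ).symm
  have e4 : ∀ a τ, h a (-4) τ = h a 0 τ := fun a τ => (hb4 a (-4) τ).symm
  have e5 : ∀ a τ, h a (-5) τ = h a 3 τ := fun a τ => ((hb4 a (-5) τ).symm).trans (e1 a τ)
  have e6 : ∀ a τ, h a (-6) τ = h a 2 τ := fun a τ => ((hb4 a (-6) τ).symm).trans (e2 a τ)
  have e7 : ∀ a τ, h a (-7) τ = h a 1 τ := fun a τ => ((hb4 a (-7) τ).symm).trans (e3 a τ)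
  have t1 : ∀ τ z, thetaJ 4 (-1) τ z = thetaJ 4 7 τ z := fun τ z => (thetaJ_period (-1) τ z).symm
  have t2 : ∀ τ z, thetaJ 4 (-2) τ z = thetaJ 4 6 τ z := fun τ z => (thetaJ_period (-2) τ z).symm
  have t3 : ∀ τ z, thetaJ 4 (-3) τ z = thetaJ 4 5 τ z := fun τ z => (thetaJ_period (-3) τ z).symm
  have t4 : ∀ τ z, thetaJ 4 (-4) τ z = thetaJ 4 4 τ z := fun τ z => (thetaJ_period (-4) τ z).symm
  have t5 : ∀ τ z, thetaJ 4 (-5) τ z = thetaJ 4 3 τ z := fun τ z => (thetaJ_period (-5) τ z).symm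
  have t6 : ∀ τ z, thetaJ 4 (-6) τ z = thetaJ 4 2 τ z := fun τ z => (thetaJ_period (-6) τ z).symm
  have t7 : ∀ τ z, thetaJ 4 (-7) τ z = thetaJ 4 1 τ z := fun τ z => (thetaJ_period (-7) τ z).symm
  have t8 : ∀ τ z, thetaJ 4 8 τ z = thetaJ 4 0 τ z := fun τ z => thetaJ_period 0 τ z
  have t9 : ∀ τ z, thetaJ 4 9 τ z = thetaJ 4 1 τ z := fun τ z => thetaJ_period 1 τ z
  have t10 : ∀ τ z, thetaJ 4 10 τ z = thetaJ 4 2 τ z := fun τ z => thetaJ_period 2 τ z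
  have part1 : ∀ τ z : ℂ, UHP τ →
      φ τ ((1 + Complex.I) * z) ((1 - Complex.I) * z)
        = ∑ μ ∈ Finset.range 8, HbarF h (μ : ℤ) τ * thetaJ 4 (μ : ℤ) τ z := by
    intro τ z hτ
    rw [hdec.2 τ _ _ hτ]
    simp_rw [thetaH_split _ _ τ z hτ]
    simp only [HbarF, Finset.sum_range_succ, Finset.sum_range_zero, Nat.reduceMul]
    norm_num
    simp only [e1, e2, e3, e4, e5, e6, e7, t1, t2, t3, t4, t5, t6, t7, t8, t9, t10]
    ring
  have hper : ∀ (τ : ℂ) (μ : ℤ), HbarF h (μ + 8) τ = HbarF h μ τ := by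
    intro τ μ
    unfold HbarF
    refine Finset.sum_congr rfl fun a _ => ?_
    have h1 := hb4 a (a - (μ + 8)) τ
    have h2 := hb4 a (a - (μ + 8) + 4) τ
    have h3 := thetaJ_period (2 * a - (μ + 8)) τ 0
    rw [show (a : ℤ) - (μ + 8) + 4 + 4 = a - μ by ring] at h2
    rw [show 2 * (a : ℤ) - (μ + 8) + 8 = 2 * a - μ by ring] at h3
    rw [h3, h2, h1]
  refine ⟨part1, ?_, ?_, ?_, ?_, ?_, ?_⟩
  · intro ν τ hτ
    have hsym : ∀ z : ℂ, φ τ ((1 + Complex.I) * (-z)) ((1 - Complex.I) * (-z))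
        = (-1 : ℂ) ^ k * φ τ ((1 + Complex.I) * z) ((1 - Complex.I) * z) := by
      intro z
      have := hφ.transf (-1) (by simp) 1 τ ((1 + Complex.I) * z) ((1 - Complex.I) * z) hτ
      simp [Ma, Mb, Mc, Md, eC_zero] at this
      rw [← this]
      congr 1 <;> ring
    have c1 := thetaSum_coeff (fun μ => HbarF h μ τ) (hper τ) ν τ hτ
    have c2 := thetaSum_coeff_neg (fun μ => HbarF h μ τ) (hper τ) ν τ hτ
    simp_rw [← part1 τ _ hτ] at c1 c2
    simp_rw [hsym, mul_assoc] at c2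
    rw [intervalIntegral.integral_const_mul] at c2
    rw [c1] at c2
    have hne : eC ((ν : ℂ) ^ 2 / 16 * τ) ≠ 0 := Complex.exp_ne_zero _
    rw [← mul_assoc] at c2
    have c3 := mul_right_cancel₀ hne c2
    rw [← c3, ← mul_assoc, ← mul_pow]
    simp
  all_goals
    intro τ _
    simp only [HbarF, Finset.sum_range_succ, Finset.sum_range_zero]
    norm_num
    try simp only [e1, e2, e3, e4, e5, e6, e7, t1, t2, t3, t4, t5, t6, t7, t8, t9, t10]
    try ring
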